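/- arXiv:math/0209402 — 11 statements merged into one kernel-verified Lean document; each statement's English description precedes it below -/
import Mathlib

section
/- Suppose the alternating bilinear form α on V is J-anti-invariant and the linear map K : V →ₗ[ℝ] V represents α. Then for all v₁, v₂ ∈ V: ⟪v₁ + J v₂, K v₂ - J (K v₁)⟫ + ⟪v₂ - J v₁, -(K v₁) - J (K v₂)⟫ = 4 α(v₁, v₂). (This is the pointwise content of Proposition 1.3(b): ⟨∂̄_J f, K_J(f,α)⟩ dv = f*α, with v₁ = df(e₁), v₂ = df(e₂) for an orthonormal frame e₁, e₂ = j e₁.) -/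
open scoped RealInnerProductSpace

/-- Pointwise content of Proposition 1.3(b):
`⟨∂̄_J f, K_J(f,α)⟩ dv = f*α`, with `v₁ = df(e₁)`, `v₂ = df(e₂)`. -/
theorem stmt_2 {V : Type*} [NormedAddCommGroup V] [InnerProductSpace ℝ V]
    (J : V →ₗ[ℝ] V)
    (hJ2 : J ∘ₗ J = -(LinearMap.id : V →ₗ[ℝ] V))
    (hJorth : ∀ u v : V, ⟪J u, J v⟫ = ⟪u, v⟫)
    (α : V →ₗ[ℝ] V →ₗ[ℝ] ℝ)
    (halt : ∀ u : V, α u u = 0)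
    (hanti : ∀ u v : V, α (J u) (J v) = -α u v)
    (K : V →ₗ[ℝ] V)
    (hK : ∀ u v : V, ⟪u, K v⟫ = α u v)
    (v₁ v₂ : V) :
    ⟪v₁ + J v₂, K v₂ - J (K v₁)⟫ + ⟪v₂ - J v₁, -(K v₁) - J (K v₂)⟫
      = 4 * α v₁ v₂ := by
  have hJJ (u : V) : J (J u) = -u := by simpa using LinearMap.congr_fun hJ2 u
  have hskew (u w : V) : ⟪u, J w⟫ = -⟪J u, w⟫ := by
    rw [← hJorth u (J w), hJJ, inner_neg_right]
  have hswap (u v : V) : α v u = -α u v := by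
    have h := halt (u + v)
    simp only [map_add, LinearMap.add_apply, halt] at h
    linarith
  have hzero (u : V) : α (J u) u = 0 := by
    have h := hanti (J u) u
    simp only [hJJ, map_neg, LinearMap.neg_apply] at h
    linarith [hswap u (J u)]
  simp only [inner_sub_right, inner_neg_right, hskew, hK, map_add, map_sub, map_neg,
    LinearMap.add_apply, LinearMap.sub_apply, LinearMap.neg_apply, hJJ, hzero, hswap v₁ v₂]
  ring
end

section
/- Assume moreover that V is 4-dimensional, that the alternating bilinear form α on V is J-anti-invariant, and that the linear map K : V →ₗ[ℝ] V represents α. Then there exists a real constant c ≥ 0 such that K ∘ K = -c • id; moreover c = ‖K v‖² for every unit vector v ∈ V. (This is Proposition 1.3(c): K_α² = -|α|² Id on a 4-dimensional almost Kähler vector space.) -/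
open scoped RealInnerProductSpace

/-- In dimension four, a vector orthogonal to four nonzero pairwise orthogonal vectors vanishes. -/
theorem eq_zero_of_inner_eq_zero_of_finrank_eq_four {V : Type*} [NormedAddCommGroup V]
    [InnerProductSpace ℝ V] [FiniteDimensional ℝ V] (hdim : Module.finrank ℝ V = 4)
    (b : Fin 4 → V) (hb : ∀ i, b i ≠ 0) (horth : Pairwise fun i j => ⟪b i, b j⟫ = 0)
    (x : V) (hx : ∀ i, ⟪b i, x⟫ = 0) : x = 0 := by
  have hli : LinearIndependent ℝ b := linearIndependent_of_ne_zero_of_inner_eq_zero hb horth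
  have hspan := hli.span_eq_top_of_card_eq_finrank' (by simp [hdim])
  have hmem : x ∈ Submodule.span ℝ (Set.range b) := hspan ▸ Submodule.mem_top
  have key : ∀ y ∈ Submodule.span ℝ (Set.range b), ⟪y, x⟫ = 0 := by
    intro y hy
    induction hy using Submodule.span_induction with
    | mem y hy => obtain ⟨i, rfl⟩ := hy; exact hx i
    | zero => simp
    | add y z _ _ hy hz => rw [inner_add_left, hy, hz, add_zero]
    | smul a y _ hy => rw [inner_smul_left, hy, mul_zero]
  exact inner_self_eq_zero.mp (key x hmem)

/-- Proposition 1.3(c): on a 4-dimensional almost Kähler vector space,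
`K_α² = -|α|² Id`, with `|α|² = ‖K v‖²` for any unit vector `v`. -/
theorem stmt_3 {V : Type*} [NormedAddCommGroup V] [InnerProductSpace ℝ V]
    [FiniteDimensional ℝ V] (hdim : Module.finrank ℝ V = 4)
    (J : V →ₗ[ℝ] V)
    (hJ2 : J ∘ₗ J = -(LinearMap.id : V →ₗ[ℝ] V))
    (hJorth : ∀ u v : V, ⟪J u, J v⟫ = ⟪u, v⟫)
    (α : V →ₗ[ℝ] V →ₗ[ℝ] ℝ)
    (halt : ∀ u : V, α u u = 0)
    (hanti : ∀ u v : V, α (J u) (J v) = -α u v)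
    (K : V →ₗ[ℝ] V)
    (hK : ∀ u v : V, ⟪u, K v⟫ = α u v) :
    ∃ c : ℝ, 0 ≤ c ∧ K ∘ₗ K = -(c • (LinearMap.id : V →ₗ[ℝ] V)) ∧
      ∀ v : V, ‖v‖ = 1 → c = ‖K v‖ ^ 2 := by
  have hJJ (v : V) : J (J v) = -v := by simpa using LinearMap.congr_fun hJ2 v
  have hJskew (u v : V) : ⟪J u, v⟫ = -⟪u, J v⟫ := by
    rw [← hJorth u (J v), hJJ, inner_neg_right, neg_neg]
  have hKskew (u v : V) : ⟪K u, v⟫ = -⟪u, K v⟫ := by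
    have h := halt (u + v)
    simp only [map_add, LinearMap.add_apply, halt] at h
    rw [real_inner_comm, hK, hK]
    linarith
  have hKJ (v : V) : K (J v) = -J (K v) := by
    refine ext_inner_left ℝ fun u => ?_
    have h := hanti (J u) v
    rw [hJJ, ← hK, ← hK, inner_neg_left, hJskew] at h
    rw [inner_neg_right]
    linarith
  have hvJ (v : V) : ⟪v, J v⟫ = 0 := by
    linarith [hJskew v v, real_inner_comm v (J v)]
  have hvK (v : V) : ⟪v, K v⟫ = 0 := by rw [hK, halt]
  have hJK (v : V) : ⟪J v, K v⟫ = 0 := by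
    have h₁ := hJskew v (K v)
    have h₂ := hKskew v (J v)
    rw [hKJ, inner_neg_right, real_inner_comm] at h₂
    linarith
  have hvJK (v : V) : ⟪v, J (K v)⟫ = 0 := by linarith [hJskew v (K v), hJK v]
  by_cases hK0 : ∃ v, K v ≠ 0
  · obtain ⟨v, hKv⟩ := hK0
    have hv : v ≠ 0 := by rintro rfl; exact hKv (map_zero K)
    have hJne {w : V} (hw : w ≠ 0) : J w ≠ 0 := fun h => hw (by simpa [h] using hJJ w)
    let b : Fin 4 → V := ![v, J v, K v, J (K v)]
    have hb (i : Fin 4) : b i ≠ 0 := by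
      fin_cases i
      exacts [hv, hJne hv, hKv, hJne hKv]
    have hlt (i j : Fin 4) (hij : i < j) : ⟪b i, b j⟫ = 0 := by
      fin_cases i <;> fin_cases j <;>
        first
        | exact absurd hij (by decide)
        | simp [b, hvJ, hvK, hJK, hvJK, hJorth]
    have horth : Pairwise fun i j => ⟪b i, b j⟫ = 0 := by
      intro i j hij
      rcases lt_or_gt_of_ne hij with h | h
      · exact hlt i j h
      · rw [real_inner_comm]; exact hlt j i h
    have hzero := eq_zero_of_inner_eq_zero_of_finrank_eq_four hdim b hb horth
    have hvv : ⟪v, v⟫ ≠ 0 := inner_self_ne_zero.mpr hv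
    let c : ℝ := ⟪K v, K v⟫ / ⟪v, v⟫
    have hKKv : K (K v) + c • v = 0 := by
      refine hzero _ fun i => ?_
      rw [inner_add_right, inner_smul_right]
      fin_cases i
      · have h := hKskew v (K v)
        have : c * ⟪v, v⟫ = ⟪K v, K v⟫ := div_mul_cancel₀ _ hvv
        simp only [b, Fin.zero_eta, Matrix.cons_val_zero]
        linarith
      · have h := hKskew (J v) (K v)
        rw [hKJ, inner_neg_left, real_inner_comm, hvJ] at h
        have h' := hvJ v
        rw [real_inner_comm] at h'
        have h₀ : ⟪J v, K (K v)⟫ = 0 := by linarith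
        simp [b, h', h₀]
      · have h' := hvK v
        rw [real_inner_comm] at h'
        simp [b, h', hvK]
      · have h' := hvJK v
        rw [real_inner_comm] at h'
        simp [b, h', hJK]
    have hKKv' : K (K v) = -(c • v) := eq_neg_of_add_eq_zero_left hKKv
    have hKKb (i : Fin 4) : K (K (b i)) = -(c • b i) := by
      fin_cases i <;> simp [b, hKJ, hKKv']
    have hKK (x : V) : K (K x) = -(c • x) := by
      refine eq_neg_of_add_eq_zero_left (hzero _ fun i => ?_)
      have h₁ := hKskew (b i) (K x)
      have h₂ := hKskew (K (b i)) x
      rw [hKKb, inner_neg_left, real_inner_smul_left] at h₂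
      rw [inner_add_right, inner_smul_right]
      linarith
    refine ⟨c, div_nonneg real_inner_self_nonneg real_inner_self_nonneg,
      LinearMap.ext fun x => by simpa using hKK x, fun w hw => ?_⟩
    rw [← real_inner_self_eq_norm_sq, hKskew, hKK, inner_neg_right, inner_smul_right,
      real_inner_self_eq_norm_sq, hw]
    ring
  · push Not at hK0
    exact ⟨0, le_rfl, LinearMap.ext fun x => by simp [hK0], fun v _ => by simp [hK0]⟩
end

section
/- For all v₁, v₂ ∈ V: ‖K v₂ - J (K v₁)‖² + ‖K v₁ + J (K v₂)‖² = 2c(‖v₁‖² + ‖v₂‖²) + 4c⟪J v₁, v₂⟫. (This is the pointwise content of Proposition 1.3(d): |K_J(f,α)|² dv = |α|² (½|df|² dv + f*ω), with v₁ = df(e₁), v₂ = df(e₂) for an orthonormal frame e₁, e₂ = j e₁.) -/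
open scoped RealInnerProductSpace

/-- Pointwise content of Proposition 1.3(d):
`|K_J(f,α)|² dv = |α|² (½|df|² dv + f*ω)`, with `v₁ = df(e₁)`, `v₂ = df(e₂)`. -/
theorem stmt_4 {V : Type*} [NormedAddCommGroup V] [InnerProductSpace ℝ V]
    (J : V →ₗ[ℝ] V)
    (hJ2 : J ∘ₗ J = -(LinearMap.id : V →ₗ[ℝ] V))
    (hJorth : ∀ u v : V, ⟪J u, J v⟫ = ⟪u, v⟫)
    (K : V →ₗ[ℝ] V)
    (hskew : ∀ u v : V, ⟪K u, v⟫ = -⟪u, K v⟫)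
    (hanti : J ∘ₗ K = -(K ∘ₗ J))
    (c : ℝ) (hc : 0 ≤ c)
    (hKK : K ∘ₗ K = -(c • (LinearMap.id : V →ₗ[ℝ] V)))
    (v₁ v₂ : V) :
    ‖K v₂ - J (K v₁)‖ ^ 2 + ‖K v₁ + J (K v₂)‖ ^ 2
      = 2 * c * (‖v₁‖ ^ 2 + ‖v₂‖ ^ 2) + 4 * c * ⟪J v₁, v₂⟫ := by
  have hJJ (u : V) : J (J u) = -u := by simpa using LinearMap.congr_fun hJ2 u
  have hJK (u : V) : J (K u) = -K (J u) := by simpa using LinearMap.congr_fun hanti u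
  have hK2 (u : V) : K (K u) = -(c • u) := by simpa using LinearMap.congr_fun hKK u
  have hKinner (u v : V) : ⟪K u, K v⟫ = c * ⟪u, v⟫ := by
    rw [hskew, hK2, inner_neg_right, neg_neg, real_inner_smul_right]
  have hKnorm (u : V) : ‖K u‖ ^ 2 = c * ‖u‖ ^ 2 := by
    rw [← real_inner_self_eq_norm_sq, hKinner, real_inner_self_eq_norm_sq]
  have hJnorm (u : V) : ‖J u‖ ^ 2 = ‖u‖ ^ 2 := by
    rw [← real_inner_self_eq_norm_sq, hJorth, real_inner_self_eq_norm_sq]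
  have hcross₁ : ⟪K v₂, J (K v₁)⟫ = -(c * ⟪J v₁, v₂⟫) := by
    rw [hJK, inner_neg_right, hKinner, real_inner_comm]
  have hcross₂ : ⟪K v₁, J (K v₂)⟫ = c * ⟪J v₁, v₂⟫ := by
    rw [hJK, inner_neg_right, hKinner, ← hJorth v₁ (J v₂), hJJ, inner_neg_right]
    ring
  rw [norm_sub_sq_real, norm_add_sq_real, hJnorm, hJnorm, hKnorm, hKnorm, hcross₁, hcross₂]
  ring
end

section
/- For all v₁, v₂ ∈ V: ‖K v₂ - J (K v₁)‖² + ‖K v₁ + J (K v₂)‖² = c(‖v₁ - J v₂‖² + ‖v₂ + J v₁‖²). (This is the identity |K_J(f,α)|² = |α|² |∂_J f|² from the proof of Proposition 1.3, where 4|∂_J f|² = ‖v₁ - J v₂‖² + ‖v₂ + J v₁‖² and 4|K_J(f,α)|² = ‖K v₂ - J K v₁‖² + ‖K v₁ + J K v₂‖² with v₁ = df(e₁), v₂ = df(e₂).) -/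
open scoped RealInnerProductSpace

/-- A skew-adjoint operator squaring to `-c` scales squared norms by `c`. -/
theorem norm_sq_apply_of_skew_of_comp_self {V : Type*} [NormedAddCommGroup V]
    [InnerProductSpace ℝ V] {K : V →ₗ[ℝ] V} {c : ℝ}
    (hskew : ∀ u v : V, ⟪K u, v⟫ = -⟪u, K v⟫)
    (hKK : K ∘ₗ K = -(c • (LinearMap.id : V →ₗ[ℝ] V))) (w : V) :
    ‖K w‖ ^ 2 = c * ‖w‖ ^ 2 := by
  have hw : K (K w) = -(c • w) := by simpa using LinearMap.congr_fun hKK w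
  rw [← real_inner_self_eq_norm_sq, ← real_inner_self_eq_norm_sq, hskew, hw, inner_neg_right,
    real_inner_smul_right, neg_neg]

/-- The identity `|K_J(f,α)|² = |α)|² |∂_J f|²` from the proof of Proposition 1.3,
with `v₁ = df(e₁)`, `v₂ = df(e₂)`. -/
theorem stmt_5 {V : Type*} [NormedAddCommGroup V] [InnerProductSpace ℝ V]
    (J : V →ₗ[ℝ] V)
    (hJ2 : J ∘ₗ J = -(LinearMap.id : V →ₗ[ℝ] V))
    (hJorth : ∀ u v : V, ⟪J u, J v⟫ = ⟪u, v⟫)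
    (K : V →ₗ[ℝ] V)
    (hskew : ∀ u v : V, ⟪K u, v⟫ = -⟪u, K v⟫)
    (hanti : J ∘ₗ K = -(K ∘ₗ J))
    (c : ℝ) (hc : 0 ≤ c)
    (hKK : K ∘ₗ K = -(c • (LinearMap.id : V →ₗ[ℝ] V)))
    (v₁ v₂ : V) :
    ‖K v₂ - J (K v₁)‖ ^ 2 + ‖K v₁ + J (K v₂)‖ ^ 2
      = c * (‖v₁ - J v₂‖ ^ 2 + ‖v₂ + J v₁‖ ^ 2) := by
  have hJK (w : V) : J (K w) = -K (J w) := by simpa using LinearMap.congr_fun hanti w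
  have h₁ : K v₂ - J (K v₁) = K (v₂ + J v₁) := by rw [hJK, map_add, sub_neg_eq_add]
  have h₂ : K v₁ + J (K v₂) = K (v₁ - J v₂) := by rw [hJK, map_sub, sub_eq_add_neg]
  rw [h₁, h₂, norm_sq_apply_of_skew_of_comp_self hskew hKK,
    norm_sq_apply_of_skew_of_comp_self hskew hKK]
  ring
end

section
/- Suppose the alternating bilinear form α on V is J-anti-invariant, the linear map K : V →ₗ[ℝ] V represents α, and v₁, v₂ ∈ V satisfy the pointwise (J,α)-holomorphic equation v₁ + J v₂ = K v₂ - J (K v₁). Then ‖v₁ + J v₂‖² + ‖v₂ - J v₁‖² = 4 α(v₁, v₂). (This is the pointwise content of Corollary 1.4(a): |∂̄_J f|² dv = f*α for a (J,α)-holomorphic map f.) -/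
open scoped RealInnerProductSpace

theorem LinearMap.apply_self_eq_zero_of_antiInvariant {V : Type*} [AddCommGroup V] [Module ℝ V]
    {J : V →ₗ[ℝ] V} (hJ : ∀ u : V, J (J u) = -u) {α : V →ₗ[ℝ] V →ₗ[ℝ] ℝ} (halt : α.IsAlt)
    (hanti : ∀ u v : V, α (J u) (J v) = -α u v) (u : V) : α (J u) u = 0 := by
  have h := hanti (J u) u
  rw [hJ, map_neg, LinearMap.neg_apply] at h
  linarith [halt.neg u (J u)]

/-- Pointwise content of Corollary 1.4(a):
`|∂̄_J f|² dv = f*α` for a `(J,α)`-holomorphic map `f`. -/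
theorem stmt_6 {V : Type*} [NormedAddCommGroup V] [InnerProductSpace ℝ V]
    (J : V →ₗ[ℝ] V)
    (hJ2 : J ∘ₗ J = -(LinearMap.id : V →ₗ[ℝ] V))
    (hJorth : ∀ u v : V, ⟪J u, J v⟫ = ⟪u, v⟫)
    (α : V →ₗ[ℝ] V →ₗ[ℝ] ℝ)
    (halt : ∀ u : V, α u u = 0)
    (hanti : ∀ u v : V, α (J u) (J v) = -α u v)
    (K : V →ₗ[ℝ] V)
    (hK : ∀ u v : V, ⟪u, K v⟫ = α u v)
    (v₁ v₂ : V)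
    (hholo : v₁ + J v₂ = K v₂ - J (K v₁)) :
    ‖v₁ + J v₂‖ ^ 2 + ‖v₂ - J v₁‖ ^ 2 = 4 * α v₁ v₂ := by
  have hJ (u : V) : J (J u) = -u := by simpa using LinearMap.congr_fun hJ2 u
  have hskew : ⟪v₁, J (K v₁)⟫ = 0 := by
    rw [← hJorth, hJ, inner_neg_right, hK,
      LinearMap.apply_self_eq_zero_of_antiInvariant hJ halt hanti, neg_zero]
  have hrot : ‖v₂ - J v₁‖ ^ 2 = ‖v₁ + J v₂‖ ^ 2 := by
    rw [show v₂ - J v₁ = -J (v₁ + J v₂) by rw [map_add, hJ]; abel, norm_neg,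
      ← real_inner_self_eq_norm_sq, hJorth, real_inner_self_eq_norm_sq]
  have hsq : ‖v₁ + J v₂‖ ^ 2 = 2 * α v₁ v₂ := by
    rw [← real_inner_self_eq_norm_sq]
    nth_rewrite 2 [hholo]
    rw [inner_sub_right, inner_add_left, inner_add_left, hJorth, hskew, hK, hK, hK,
      LinearMap.apply_self_eq_zero_of_antiInvariant hJ halt hanti,
      ← LinearMap.IsAlt.neg halt v₁ v₂]
    ring
  rw [hrot, hsq]
  ring
end

section
/- Suppose v₁, v₂ ∈ V satisfy the pointwise (J,α)-holomorphic equation v₁ + J v₂ = K v₂ - J (K v₁). Then (1 - c)(‖v₁‖² + ‖v₂‖²) = 2(1 + c)⟪J v₁, v₂⟫. (This is the pointwise content of Corollary 1.4(b): (1 - |α|²)|df|² dv = 2(1 + |α|²) f*ω for a (J,α)-holomorphic map f, with v₁ = df(e₁), v₂ = df(e₂).) -/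
open scoped RealInnerProductSpace

/-- Pointwise content of Corollary 1.4(b):
`(1 - |α|²)|df|² dv = 2(1 + |α|²) f*ω` for a `(J,α)`-holomorphic map `f`. -/
theorem stmt_7 {V : Type*} [NormedAddCommGroup V] [InnerProductSpace ℝ V]
    (J : V →ₗ[ℝ] V)
    (hJ2 : J ∘ₗ J = -(LinearMap.id : V →ₗ[ℝ] V))
    (hJorth : ∀ u v : V, ⟪J u, J v⟫ = ⟪u, v⟫)
    (K : V →ₗ[ℝ] V)
    (hskew : ∀ u v : V, ⟪K u, v⟫ = -⟪u, K v⟫)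
    (hanti : J ∘ₗ K = -(K ∘ₗ J))
    (c : ℝ) (hc : 0 ≤ c)
    (hKK : K ∘ₗ K = -(c • (LinearMap.id : V →ₗ[ℝ] V)))
    (v₁ v₂ : V)
    (hholo : v₁ + J v₂ = K v₂ - J (K v₁)) :
    (1 - c) * (‖v₁‖ ^ 2 + ‖v₂‖ ^ 2) = 2 * (1 + c) * ⟪J v₁, v₂⟫ := by
  have hJJ (u : V) : J (J u) = -u := by simpa using LinearMap.congr_fun hJ2 u
  have hJK (u : V) : J (K u) = -K (J u) := by simpa using LinearMap.congr_fun hanti u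
  have hKK' (u : V) : K (K u) = -(c • u) := by simpa using LinearMap.congr_fun hKK u
  have hK_norm (u : V) : ‖K u‖ ^ 2 = c * ‖u‖ ^ 2 := by
    rw [← real_inner_self_eq_norm_sq, hskew, hKK', inner_neg_right, neg_neg,
      real_inner_smul_right, real_inner_self_eq_norm_sq]
  have hJ_norm (u : V) : ‖J u‖ ^ 2 = ‖u‖ ^ 2 := by
    rw [← real_inner_self_eq_norm_sq, hJorth, real_inner_self_eq_norm_sq]
  have hJ_skew : ⟪v₁, J v₂⟫ = -⟪J v₁, v₂⟫ := by
    rw [← hJorth v₁, hJJ, inner_neg_right]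
  have hw : v₁ + J v₂ = K (J v₁ + v₂) := by
    rw [hholo, hJK, map_add]
    abel
  have key : ‖v₁ + J v₂‖ ^ 2 = c * ‖J v₁ + v₂‖ ^ 2 := by rw [hw, hK_norm]
  rw [norm_add_sq_real, norm_add_sq_real, hJ_norm, hJ_norm, hJ_skew] at key
  linarith
end

section
/- Suppose v₁, v₂ ∈ V satisfy the pointwise (J,α)-holomorphic equation v₁ + J v₂ = K v₂ - J (K v₁). Then 4c(‖v₁‖² + ‖v₂‖²) = (1 + c)(‖v₁ + J v₂‖² + ‖v₂ - J v₁‖²). (This is the pointwise content of Corollary 1.4(c): |α|² |df|² = (1 + |α|²)|∂̄_J f|² for a (J,α)-holomorphic map f, with v₁ = df(e₁), v₂ = df(e₂) and 4|∂̄_J f|² = ‖v₁ + J v₂‖² + ‖v₂ - J v₁‖².) -/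
open scoped RealInnerProductSpace

/-- Pointwise content of Corollary 1.4(c):
`|α|² |df|² = (1 + |α|²)|∂̄_J f|²` for a `(J,α)`-holomorphic map `f`. -/
theorem stmt_8 {V : Type*} [NormedAddCommGroup V] [InnerProductSpace ℝ V]
    (J : V →ₗ[ℝ] V)
    (hJ2 : J ∘ₗ J = -(LinearMap.id : V →ₗ[ℝ] V))
    (hJorth : ∀ u v : V, ⟪J u, J v⟫ = ⟪u, v⟫)
    (K : V →ₗ[ℝ] V)
    (hskew : ∀ u v : V, ⟪K u, v⟫ = -⟪u, K v⟫)
    (hanti : J ∘ₗ K = -(K ∘ₗ J))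
    (c : ℝ) (hc : 0 ≤ c)
    (hKK : K ∘ₗ K = -(c • (LinearMap.id : V →ₗ[ℝ] V)))
    (v₁ v₂ : V)
    (hholo : v₁ + J v₂ = K v₂ - J (K v₁)) :
    4 * c * (‖v₁‖ ^ 2 + ‖v₂‖ ^ 2)
      = (1 + c) * (‖v₁ + J v₂‖ ^ 2 + ‖v₂ - J v₁‖ ^ 2) := by
  have hJJ : ∀ u, J (J u) = -u := fun u => by simpa using LinearMap.congr_fun hJ2 u
  have hJK : ∀ u, J (K u) = -K (J u) := fun u => by simpa using LinearMap.congr_fun hanti u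
  have hKK' : ∀ u, K (K u) = -(c • u) := fun u => by simpa using LinearMap.congr_fun hKK u
  have hJnorm : ∀ u, ‖J u‖ ^ 2 = ‖u‖ ^ 2 := fun u => by
    rw [← real_inner_self_eq_norm_sq, ← real_inner_self_eq_norm_sq, hJorth]
  have hKnorm : ∀ u, ‖K u‖ ^ 2 = c * ‖u‖ ^ 2 := fun u => by
    rw [← real_inner_self_eq_norm_sq, hskew, hKK', inner_neg_right, neg_neg,
      real_inner_smul_right, real_inner_self_eq_norm_sq]
  have h_rotate : v₂ - J v₁ = -J (v₁ + J v₂) := by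
    rw [map_add, hJJ]; abel
  have h_holo : v₁ + J v₂ = K (J (v₁ - J v₂)) := by
    rw [hholo, hJK, map_sub, hJJ, map_sub, map_neg]; abel
  have h_norm_rotate : ‖v₂ - J v₁‖ ^ 2 = ‖v₁ + J v₂‖ ^ 2 := by
    rw [h_rotate, norm_neg, hJnorm]
  have h_norm_holo : ‖v₁ + J v₂‖ ^ 2 = c * ‖v₁ - J v₂‖ ^ 2 := by
    rw [h_holo, hKnorm, hJnorm]
  have h_par := parallelogram_law_with_norm ℝ v₁ (J v₂)
  have h_norm := hJnorm v₂
  rw [h_norm_rotate]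
  linear_combination (-2 * c) * h_par - 2 * h_norm_holo - 4 * c * h_norm
end

section
/- Suppose the alternating bilinear form α on V is J-anti-invariant, the linear map K : V →ₗ[ℝ] V represents α, and v₁, v₂ ∈ V satisfy the pointwise (J,α)-holomorphic equation v₁ + J v₂ = K v₂ - J (K v₁). Then ‖v₁‖² + ‖v₂‖² = 2⟪J v₁, v₂⟫ + 2 α(v₁, v₂). (This is the pointwise energy identity ½|df|² dv = f*ω + f*α used in Lemma 4.2 to show that the energy of a (J,α)-holomorphic map representing a class A equals ω(A) + α(A).) -/
open scoped RealInnerProductSpace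

/-- An orthogonal complex structure is skew-adjoint. -/
theorem inner_complexStructure_right {V : Type*} [NormedAddCommGroup V] [InnerProductSpace ℝ V]
    {J : V →ₗ[ℝ] V} (hJ2 : J ∘ₗ J = -(LinearMap.id : V →ₗ[ℝ] V))
    (hJorth : ∀ u v : V, ⟪J u, J v⟫ = ⟪u, v⟫) (u v : V) : ⟪u, J v⟫ = -⟪J u, v⟫ := by
  have hJJ : J (J v) = -v := by simpa using LinearMap.congr_fun hJ2 v
  rw [← hJorth, hJJ, inner_neg_right]

/-- A `J`-anti-invariant alternating form vanishes on every complex line. -/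
theorem antiInvariant_apply_self_eq_zero {V : Type*} [AddCommGroup V] [Module ℝ V]
    {J : V →ₗ[ℝ] V} (hJ2 : J ∘ₗ J = -(LinearMap.id : V →ₗ[ℝ] V))
    {α : V →ₗ[ℝ] V →ₗ[ℝ] ℝ} (halt : α.IsAlt)
    (hanti : ∀ u v : V, α (J u) (J v) = -α u v) (u : V) : α (J u) u = 0 := by
  have hJJ : J (J u) = -u := by simpa using LinearMap.congr_fun hJ2 u
  have h := hanti (J u) u
  rw [hJJ, map_neg, LinearMap.neg_apply, halt.neg u (J u)] at h
  linarith

/-- Pointwise energy identity `½|df|² dv = f*ω + f*α` (used in Lemma 4.2)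
for a `(J,α)`-holomorphic map, with `v₁ = df(e₁)`, `v₂ = df(e₂)`. -/
theorem stmt_9 {V : Type*} [NormedAddCommGroup V] [InnerProductSpace ℝ V]
    (J : V →ₗ[ℝ] V)
    (hJ2 : J ∘ₗ J = -(LinearMap.id : V →ₗ[ℝ] V))
    (hJorth : ∀ u v : V, ⟪J u, J v⟫ = ⟪u, v⟫)
    (α : V →ₗ[ℝ] V →ₗ[ℝ] ℝ)
    (halt : ∀ u : V, α u u = 0)
    (hanti : ∀ u v : V, α (J u) (J v) = -α u v)
    (K : V →ₗ[ℝ] V)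
    (hK : ∀ u v : V, ⟪u, K v⟫ = α u v)
    (v₁ v₂ : V)
    (hholo : v₁ + J v₂ = K v₂ - J (K v₁)) :
    ‖v₁‖ ^ 2 + ‖v₂‖ ^ 2 = 2 * ⟪J v₁, v₂⟫ + 2 * α v₁ v₂ := by
  have hskew := inner_complexStructure_right hJ2 hJorth
  have hline := antiInvariant_apply_self_eq_zero hJ2 halt hanti
  have hswap := LinearMap.IsAlt.neg halt v₁ v₂
  have h₁ : ‖v₁‖ ^ 2 - ⟪J v₁, v₂⟫ = α v₁ v₂ := by
    have h := congrArg (fun w => ⟪v₁, w⟫) hholo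
    simpa [inner_add_right, inner_sub_right, hskew, hK, hline, sub_eq_add_neg] using h
  have h₂ : ‖v₂‖ ^ 2 - ⟪J v₁, v₂⟫ = α v₁ v₂ := by
    have h := congrArg (fun w => ⟪J v₂, w⟫) hholo
    simp only [inner_add_right, inner_sub_right, hJorth, hK, hline,
      real_inner_self_eq_norm_sq, real_inner_comm v₁ (J v₂)] at h
    linarith [hskew v₁ v₂, real_inner_comm v₁ (J v₂)]
  linarith
end

section
/- Suppose v₁, v₂ ∈ V satisfy the pointwise (J,α)-holomorphic equation v₁ + J v₂ = K v₂ - J (K v₁). If ⟪J v₁, v₂⟫ ≥ 0 and not both v₁ and v₂ are zero, then c ≤ 1. (This is the pointwise ingredient of Lemma 4.2: on a K3 or Abelian surface with Ricci-flat metric, |α| is constant and any nonconstant (J,α)-holomorphic map with ω(A) ≥ 0 forces |α| ≤ 1.) -/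
open scoped RealInnerProductSpace

/-- Pointwise ingredient of Lemma 4.2: a nontrivial `(J,α)`-holomorphic point
with `f*ω ≥ 0` forces `|α|² ≤ 1`. -/
theorem stmt_10 {V : Type*} [NormedAddCommGroup V] [InnerProductSpace ℝ V]
    (J : V →ₗ[ℝ] V)
    (hJ2 : J ∘ₗ J = -(LinearMap.id : V →ₗ[ℝ] V))
    (hJorth : ∀ u v : V, ⟪J u, J v⟫ = ⟪u, v⟫)
    (K : V →ₗ[ℝ] V)
    (hskew : ∀ u v : V, ⟪K u, v⟫ = -⟪u, K v⟫)
    (hanti : J ∘ₗ K = -(K ∘ₗ J))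
    (c : ℝ) (hc : 0 ≤ c)
    (hKK : K ∘ₗ K = -(c • (LinearMap.id : V →ₗ[ℝ] V)))
    (v₁ v₂ : V)
    (hholo : v₁ + J v₂ = K v₂ - J (K v₁))
    (hω : 0 ≤ ⟪J v₁, v₂⟫)
    (hne : ¬(v₁ = 0 ∧ v₂ = 0)) :
    c ≤ 1 := by
  have hJJ (x : V) : J (J x) = -x := by simpa using LinearMap.congr_fun hJ2 x
  have hJK (x : V) : J (K x) = -K (J x) := by simpa using LinearMap.congr_fun hanti x
  have hKK' (x : V) : K (K x) = -(c • x) := by simpa using LinearMap.congr_fun hKK x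
  have hsum : v₁ + J v₂ = J (K (J v₂ - v₁)) := by
    rw [hholo, map_sub, map_sub, hJK (J v₂), hJJ, map_neg, neg_neg]
  have hnorm : ⟪v₁ + J v₂, v₁ + J v₂⟫ = c * ⟪J v₂ - v₁, J v₂ - v₁⟫ := by
    rw [hsum, hJorth, hskew, hKK', inner_neg_right, neg_neg, real_inner_smul_right]
  have hcross : ⟪v₁, J v₂⟫ ≤ 0 := by
    rw [← hJorth, hJJ, inner_neg_right]
    linarith
  have hle : ⟪v₁ + J v₂, v₁ + J v₂⟫ ≤ ⟪J v₂ - v₁, J v₂ - v₁⟫ := by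
    rw [real_inner_add_add_self, real_inner_sub_sub_self]
    linarith [real_inner_comm v₁ (J v₂)]
  have hdiff : J v₂ - v₁ ≠ 0 := by
    intro h
    have hJv : J v₂ = v₁ := sub_eq_zero.mp h
    have hv₁ : v₁ = 0 := by
      rw [h, map_zero, map_zero, hJv, ← two_smul ℝ] at hsum
      exact (smul_eq_zero_iff_right two_ne_zero).mp hsum
    refine hne ⟨hv₁, neg_eq_zero.mp ?_⟩
    rw [← hJJ, hJv, hv₁, map_zero]
  exact le_of_mul_le_mul_right (by rwa [one_mul, ← hnorm]) (real_inner_self_pos.mpr hdiff)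
end

section
/- Define J_α := (1/(1+c)) • ((id - J ∘ K) ∘ J ∘ (id + J ∘ K)), which is the conjugate (id + J K)⁻¹ ∘ J ∘ (id + J K). Then J_α preserves the inner product: ⟪J_α u, J_α v⟫ = ⟪u, v⟫ for all u, v ∈ V. (This is the first assertion of Proposition 1.5: the almost complex structure J_α determined by a J-anti-invariant form α is compatible with the metric.) -/
open scoped RealInnerProductSpace

/-- If `L` is skew-adjoint and scales the inner product by `c`, then `id + L` scales it by
`1 + c`. -/
lemma inner_add_map_add_map_of_skew {V : Type*} [NormedAddCommGroup V] [InnerProductSpace ℝ V]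
    {L : V →ₗ[ℝ] V} {c : ℝ} (hskew : ∀ u v : V, ⟪L u, v⟫ = -⟪u, L v⟫)
    (hscale : ∀ u v : V, ⟪L u, L v⟫ = c * ⟪u, v⟫) (u v : V) :
    ⟪u + L u, v + L v⟫ = (1 + c) * ⟪u, v⟫ := by
  simp only [inner_add_left, inner_add_right, hscale, hskew u v]
  ring

/-- First assertion of Proposition 1.5: the almost complex structure
`J_α = (Id + J K)⁻¹ J (Id + J K) = (1/(1+c)) (Id - J K) J (Id + J K)`
is compatible with the metric. -/
theorem stmt_15 {V : Type*} [NormedAddCommGroup V] [InnerProductSpace ℝ V]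
    (J : V →ₗ[ℝ] V)
    (hJ2 : J ∘ₗ J = -(LinearMap.id : V →ₗ[ℝ] V))
    (hJorth : ∀ u v : V, ⟪J u, J v⟫ = ⟪u, v⟫)
    (K : V →ₗ[ℝ] V)
    (hskew : ∀ u v : V, ⟪K u, v⟫ = -⟪u, K v⟫)
    (hanti : J ∘ₗ K = -(K ∘ₗ J))
    (c : ℝ) (hc : 0 ≤ c)
    (hKK : K ∘ₗ K = -(c • (LinearMap.id : V →ₗ[ℝ] V)))
    (Jα : V →ₗ[ℝ] V)
    (hJα : Jα = (1 / (1 + c)) •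
      ((LinearMap.id - J ∘ₗ K) ∘ₗ J ∘ₗ (LinearMap.id + J ∘ₗ K))) :
    ∀ u v : V, ⟪Jα u, Jα v⟫ = ⟪u, v⟫ := by
  have hJJ (v : V) : J (J v) = -v := by simpa using LinearMap.congr_fun hJ2 v
  have hJK (v : V) : J (K v) = -K (J v) := by simpa using LinearMap.congr_fun hanti v
  have hKK' (v : V) : K (K v) = -(c • v) := by simpa using LinearMap.congr_fun hKK v
  have hL_skew (u v : V) : ⟪(J ∘ₗ K) u, v⟫ = -⟪u, (J ∘ₗ K) v⟫ := by
    rw [LinearMap.comp_apply, LinearMap.comp_apply, ← hJorth, hJJ, inner_neg_left, hskew, hJK,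
      inner_neg_right]
  have hL_scale (u v : V) : ⟪(J ∘ₗ K) u, (J ∘ₗ K) v⟫ = c * ⟪u, v⟫ := by
    rw [LinearMap.comp_apply, LinearMap.comp_apply, hJorth, hskew, hKK', inner_neg_right,
      neg_neg, real_inner_smul_right]
  have hadd := inner_add_map_add_map_of_skew hL_skew hL_scale
  have hsub (u v : V) : ⟪u - (J ∘ₗ K) u, v - (J ∘ₗ K) v⟫ = (1 + c) * ⟪u, v⟫ := by
    simpa [sub_eq_add_neg] using inner_add_map_add_map_of_skew (L := -(J ∘ₗ K)) (c := c)
      (fun u v => by simpa using congrArg Neg.neg (hL_skew u v))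
      (fun u v => by simpa using hL_scale u v) u v
  have hJα_apply (v : V) : Jα v = (1 / (1 + c)) •
      (J (v + (J ∘ₗ K) v) - (J ∘ₗ K) (J (v + (J ∘ₗ K) v))) := by
    rw [hJα]
    rfl
  intro u v
  have hc1 : 1 + c ≠ 0 := by positivity
  rw [hJα_apply, hJα_apply, real_inner_smul_left, real_inner_smul_right, hsub, hJorth, hadd]
  field_simp
end

section
/- Define J_α := (1/(1+c)) • ((id - J ∘ K) ∘ J ∘ (id + J ∘ K)), which is the conjugate (id + J K)⁻¹ ∘ J ∘ (id + J K). Then J_α = ((1-c)/(1+c)) • J - (2/(1+c)) • K. (This is the second assertion of Proposition 1.5: J_α = ((1-|α|²)/(1+|α|²)) J - (2/(1+|α|²)) K_α.) -/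
open scoped RealInnerProductSpace

/-- Second assertion of Proposition 1.5:
`J_α = ((1-c)/(1+c)) J - (2/(1+c)) K` where `c = |α|²`. -/
theorem stmt_16 {V : Type*} [NormedAddCommGroup V] [InnerProductSpace ℝ V]
    (J : V →ₗ[ℝ] V)
    (hJ2 : J ∘ₗ J = -(LinearMap.id : V →ₗ[ℝ] V))
    (hJorth : ∀ u v : V, ⟪J u, J v⟫ = ⟪u, v⟫)
    (K : V →ₗ[ℝ] V)
    (hskew : ∀ u v : V, ⟪K u, v⟫ = -⟪u, K v⟫)
    (hanti : J ∘ₗ K = -(K ∘ₗ J))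
    (c : ℝ) (hc : 0 ≤ c)
    (hKK : K ∘ₗ K = -(c • (LinearMap.id : V →ₗ[ℝ] V)))
    (Jα : V →ₗ[ℝ] V)
    (hJα : Jα = (1 / (1 + c)) •
      ((LinearMap.id - J ∘ₗ K) ∘ₗ J ∘ₗ (LinearMap.id + J ∘ₗ K))) :
    Jα = ((1 - c) / (1 + c)) • J - (2 / (1 + c)) • K := by
  have hJJ (v : V) : J (J v) = -v := by simpa using LinearMap.congr_fun hJ2 v
  have hJK (v : V) : J (K v) = -K (J v) := by simpa using LinearMap.congr_fun hanti v
  have hK2 (v : V) : K (K v) = -(c • v) := by simpa using LinearMap.congr_fun hKK v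
  subst hJα
  ext v
  simp only [LinearMap.smul_apply, LinearMap.comp_apply, LinearMap.sub_apply,
    LinearMap.add_apply, LinearMap.id_apply, map_add, map_neg, map_smul, hJK, hJJ, hK2]
  module
end
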